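/- For positive reals a₁, a₂, a₃ set Λ(a₁,a₂,a₃) = {(a₁m₁, a₂m₂, a₃m₃) : (m₁,m₂,m₃) ∈ ℤ³} and define, for t > 0, P_{a₁,a₂,a₃}(t) = ((a₁a₂a₃/4)/(4πt)^{3/2}) ∑_{v∈Λ(a₁,a₂,a₃)} e^{−‖v‖²/(4t)} + (a₁/(8√(πt))) ∑_{m∈ℤ} e^{−(m + 1/2)² a₁²/(4t)} + (a₁a₂/(16πt)) ∑_{(m,n)∈ℤ²} e^{−[a₁²m² + a₂²(n + 1/2)²]/(4t)} + (a₁a₃/(16πt)) ∑_{(m,k)∈ℤ²} e^{−[a₁²(m + 1/2)² + a₃²k²]/(4t)}. If (a₁,a₂,a₃) and (b₁,b₂,b₃) are triples of positive reals with P_{a₁,a₂,a₃}(t) = P_{b₁,b₂,b₃}(t) for all t > 0, then a₁ = b₁, a₂ = b₂ and a₃ = b₃. -/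

import Mathlib

open Real

/-- The rectangular lattice `Λ(a₁,a₂,a₃) = {(a₁m₁, a₂m₂, a₃m₃) : (m₁,m₂,m₃) ∈ ℤ³} ⊂ ℝ³`. -/
def rectLattice (a₁ a₂ a₃ : ℝ) : Set (EuclideanSpace ℝ (Fin 3)) :=
  {v | ∃ m : ℤ × ℤ × ℤ,
    v = (WithLp.equiv 2 (Fin 3 → ℝ)).symm ![a₁ * m.1, a₂ * m.2.1, a₃ * m.2.2]}

/-- The trace function `tr(H_{N₃})` of the non-orientable flat 3-manifold `N₃` with
right-angled covering torus lattice of side lengths `a₁, a₂, a₃` and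
`vol(N₃) = a₁a₂a₃/4` (Theorem A). -/
noncomputable def N3trace (a₁ a₂ a₃ t : ℝ) : ℝ :=
  (a₁ * a₂ * a₃ / 4) / (4 * π * t) ^ ((3:ℝ)/2) *
    (∑' v : rectLattice a₁ a₂ a₃, Real.exp (-‖(v : EuclideanSpace ℝ (Fin 3))‖ ^ 2 / (4 * t))) +
  a₁ / (8 * Real.sqrt (π * t)) *
    (∑' m : ℤ, Real.exp (-((m : ℝ) + 1/2) ^ 2 * a₁ ^ 2 / (4 * t))) +
  (a₁ * a₂) / (16 * π * t) *
    (∑' p : ℤ × ℤ,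
      Real.exp (-(a₁ ^ 2 * (p.1 : ℝ) ^ 2 + a₂ ^ 2 * ((p.2 : ℝ) + 1/2) ^ 2) / (4 * t))) +
  (a₁ * a₃) / (16 * π * t) *
    (∑' p : ℤ × ℤ,
      Real.exp (-(a₁ ^ 2 * ((p.1 : ℝ) + 1/2) ^ 2 + a₃ ^ 2 * (p.2 : ℝ) ^ 2) / (4 * t)))

open Filter Topology

/-- `F` is given on `s > 0` by a convergent Dirichlet series `∑ cᵢ e^{-lᵢ s}` with nonnegative
exponents `lᵢ` of which only finitely many lie below any bound. -/
def IsDirichletSum (F : ℝ → ℝ) : Prop :=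
  ∃ (ι : Type) (c l : ι → ℝ), (∀ i, 0 ≤ l i) ∧ (∀ L, {i | l i ≤ L}.Finite) ∧
    ∀ s, 0 < s → HasSum (fun i => c i * exp (-l i * s)) (F s)

theorem tendsto_mul_exp_of_hasSum {ι : Type*} {c l : ι → ℝ} {F : ℝ → ℝ} {L : ℝ}
    (hF : ∀ s, 0 < s → HasSum (fun i => c i * exp (-l i * s)) (F s))
    (hL : ∀ i, c i ≠ 0 → L ≤ l i) :
    Tendsto (fun s => F s * exp (L * s)) atTop (𝓝 (∑' i, if l i = L then c i else 0)) := by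
  have key : Tendsto (fun s => ∑' i, c i * exp (-l i * s) * exp (L * s)) atTop
      (𝓝 (∑' i, if l i = L then c i else 0)) := by
    refine tendsto_tsum_of_dominated_convergence
      (bound := fun i => ‖c i * exp (-l i * 1)‖ * exp L) ?_ ?_ ?_
    · exact (hF 1 one_pos).summable.norm.mul_right _
    · intro i
      by_cases hc : c i = 0
      · simp [hc]
      have h := hL i hc
      have e : ∀ s, c i * exp (-l i * s) * exp (L * s) = c i * exp (-((l i - L) * s)) := by
        intro s
        rw [mul_assoc, ← exp_add]
        ring_nf
      simp only [e]
      split_ifs with h'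
      · simp [h']
      · have h1 : 0 < l i - L := sub_pos.2 (lt_of_le_of_ne h (Ne.symm h'))
        have h2 := (tendsto_exp_neg_atTop_nhds_zero.comp
          (tendsto_id.const_mul_atTop h1)).const_mul (c i)
        simpa using h2
    · filter_upwards [eventually_ge_atTop 1] with s hs i
      by_cases hc : c i = 0
      · simp [hc]
      have h := hL i hc
      rw [norm_mul, norm_mul, norm_mul, mul_assoc, mul_assoc]
      refine mul_le_mul_of_nonneg_left ?_ (norm_nonneg _)
      simp only [norm_eq_abs, abs_exp, ← exp_add]
      apply exp_le_exp.2
      nlinarith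
  refine key.congr' ?_
  filter_upwards [eventually_gt_atTop 0] with s hs
  rw [tsum_mul_right, (hF s hs).tsum_eq]

theorem eq_of_tendsto_mul_exp {F : ℝ → ℝ} {L M C D : ℝ} (hC : C ≠ 0) (hD : D ≠ 0)
    (hL : Tendsto (fun s => F s * exp (L * s)) atTop (𝓝 C))
    (hM : Tendsto (fun s => F s * exp (M * s)) atTop (𝓝 D)) : L = M := by
  have main : ∀ {L M C D : ℝ}, D ≠ 0 → Tendsto (fun s => F s * exp (L * s)) atTop (𝓝 C) →
      Tendsto (fun s => F s * exp (M * s)) atTop (𝓝 D) → ¬ M < L := by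
    intro L M C D hD hL hM h
    have h2 := hL.mul (tendsto_exp_neg_atTop_nhds_zero.comp
      (tendsto_id.const_mul_atTop (sub_pos.2 h)))
    rw [mul_zero] at h2
    refine hD (tendsto_nhds_unique hM (h2.congr fun s => ?_))
    simp only [Function.comp, id]
    rw [mul_assoc, ← exp_add]
    ring_nf
  exact le_antisymm (not_lt.1 (main hD hL hM)) (not_lt.1 (main hC hM hL))

namespace IsDirichletSum

theorem add {F G : ℝ → ℝ} (hF : IsDirichletSum F) (hG : IsDirichletSum G) :
    IsDirichletSum (fun s => F s + G s) := by
  obtain ⟨ι, c, l, h0, hfin, hs⟩ := hF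
  obtain ⟨κ, d, m, h0', hfin', hs'⟩ := hG
  refine ⟨ι ⊕ κ, Sum.elim c d, Sum.elim l m, ?_, fun L => ?_, fun s hs0 => ?_⟩
  · rintro (i | i)
    exacts [h0 i, h0' i]
  · refine (((hfin L).image Sum.inl).union ((hfin' L).image Sum.inr)).subset ?_
    rintro (i | i) hi
    · exact Or.inl ⟨i, hi, rfl⟩
    · exact Or.inr ⟨i, hi, rfl⟩
  · exact HasSum.sum (f := fun i => Sum.elim c d i * exp (-Sum.elim l m i * s))
      (hs s hs0) (hs' s hs0)

theorem const_mul {F : ℝ → ℝ} (hF : IsDirichletSum F) (a : ℝ) :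
    IsDirichletSum (fun s => a * F s) := by
  obtain ⟨ι, c, l, h0, hfin, hs⟩ := hF
  refine ⟨ι, fun i => a * c i, l, h0, hfin, fun s hs0 => ?_⟩
  simpa only [mul_assoc] using (hs s hs0).mul_left a

theorem mul {F G : ℝ → ℝ} (hF : IsDirichletSum F) (hG : IsDirichletSum G) :
    IsDirichletSum (fun s => F s * G s) := by
  obtain ⟨ι, c, l, h0, hfin, hs⟩ := hF
  obtain ⟨κ, d, m, h0', hfin', hs'⟩ := hG
  refine ⟨ι × κ, fun p => c p.1 * d p.2, fun p => l p.1 + m p.2,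
    fun p => add_nonneg (h0 _) (h0' _), fun L => ?_, fun s hs0 => ?_⟩
  · refine ((hfin L).prod (hfin' L)).subset ?_
    rintro ⟨i, j⟩ hij
    have h1 := h0 i
    have h2 := h0' j
    simp only [Set.mem_ofPred_eq] at hij
    exact ⟨by simp only [Set.mem_ofPred_eq]; linarith, by simp only [Set.mem_ofPred_eq]; linarith⟩
  · have h1 := hs s hs0
    have h2 := hs' s hs0
    refine (h1.mul h2 (summable_mul_of_summable_norm h1.summable.norm h2.summable.norm)).congr_fun
      fun p => ?_
    simp only [neg_add, add_mul, exp_add]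
    ring

theorem eq_zero_or_tendsto {F : ℝ → ℝ} (hF : IsDirichletSum F) :
    (∀ s, 0 < s → F s = 0) ∨
      ∃ L C, C ≠ 0 ∧ Tendsto (fun s => F s * exp (L * s)) atTop (𝓝 C) := by
  obtain ⟨ι, c, l, -, hfin, hs⟩ := hF
  set d : ℝ → ℝ := fun L => ∑' i : {i // l i = L}, c i with hd
  have hsum : ∀ s, 0 < s → HasSum (fun L => d L * exp (-L * s)) (F s) := by
    intro s hs0
    have h1 := (Equiv.sigmaFiberEquiv l).hasSum_iff.2 (hs s hs0)
    refine h1.sigma fun L => ?_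
    have h2 := (h1.summable.sigma_factor L).hasSum
    have e : d L * exp (-L * s) = ∑' i : {i // l i = L},
        ((fun i => c i * exp (-l i * s)) ∘ Equiv.sigmaFiberEquiv l) ⟨L, i⟩ := by
      simp only [hd]
      rw [← tsum_mul_right]
      refine tsum_congr fun i => ?_
      simp [Equiv.sigmaFiberEquiv, i.2]
    rw [e]
    exact h2
  by_cases hz : ∀ L, d L = 0
  · left
    intro s hs0
    have := hsum s hs0
    simp only [hz, zero_mul] at this
    exact this.unique hasSum_zero
  right
  push Not at hz
  obtain ⟨M, hM⟩ := hz
  have hfin' : {L | d L ≠ 0 ∧ L ≤ M}.Finite := by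
    refine ((hfin M).image l).subset ?_
    rintro L ⟨hL, hLM⟩
    by_contra hcon
    have : IsEmpty {i // l i = L} := ⟨fun i => hcon ⟨i, by simpa [i.2] using hLM, i.2⟩⟩
    exact hL (by simp [hd])
  obtain ⟨L, ⟨hL, hLM⟩, hmin⟩ := Set.exists_min_image _ id hfin' ⟨M, hM, le_rfl⟩
  refine ⟨L, d L, hL, ?_⟩
  have := tendsto_mul_exp_of_hasSum (L := L) hsum fun K hK => by
    rcases le_total K M with h | h
    · exact hmin K ⟨hK, h⟩
    · exact hLM.trans h
  simpa using this

end IsDirichletSum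

theorem tendsto_pow_div_pow_mul_exp_neg {j k : ℕ} {δ : ℝ} (h : 0 < δ ∨ δ = 0 ∧ j < k) :
    Tendsto (fun r : ℝ => r ^ j / r ^ k * exp (-(δ * r ^ 2))) atTop (𝓝 0) := by
  rcases h with h | ⟨rfl, h⟩
  · have h1 : Tendsto (fun r : ℝ => r ^ j * exp (-δ * r)) atTop (𝓝 0) := by
      simpa using tendsto_rpow_mul_exp_neg_mul_atTop_nhds_zero j δ h
    refine squeeze_zero' ?_ ?_ h1
    · filter_upwards [eventually_ge_atTop 1] with r hr
      positivity
    · filter_upwards [eventually_ge_atTop 1] with r hr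
      have h2 : (1 : ℝ) ≤ r ^ k := one_le_pow₀ hr
      refine mul_le_mul (div_le_self (by positivity) h2) (exp_le_exp.2 ?_) (exp_pos _).le
        (by positivity)
      nlinarith [mul_nonneg h.le (mul_nonneg (zero_le_one.trans hr) (sub_nonneg.2 hr))]
  · simpa using tendsto_pow_div_pow_atTop_zero h

/-- Dirichlet series are linearly independent over polynomials in `√s`. -/
theorem eq_zero_of_sum_pow_mul_eq_zero {n : ℕ} {F : Fin n → ℝ → ℝ}
    (hF : ∀ k, IsDirichletSum (F k))
    (h : ∀ r : ℝ, 0 < r → ∑ k : Fin n, r ^ (k : ℕ) * F k (r ^ 2) = 0) (k : Fin n) (s : ℝ) (hs : 0 < s) :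
    F k s = 0 := by
  by_contra hne
  have hex : ∀ k, ∃ L C, (¬ ∀ s, 0 < s → F k s = 0) →
      C ≠ 0 ∧ Tendsto (fun s => F k s * exp (L * s)) atTop (𝓝 C) := by
    intro k
    rcases (hF k).eq_zero_or_tendsto with h | ⟨L, C, h⟩
    · exact ⟨0, 0, fun h' => absurd h h'⟩
    · exact ⟨L, C, fun _ => h⟩
  choose L C hLC using hex
  obtain ⟨k₀, hk₀, hmin⟩ := Set.exists_min_image {k | ¬ ∀ s, 0 < s → F k s = 0}
    (fun k => toLex (L k, -((k : ℕ) : ℤ))) (Set.toFinite _) ⟨k, fun h' => hne (h' s hs)⟩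
  have hsq : Tendsto (fun r : ℝ => r ^ 2) atTop atTop := tendsto_pow_atTop two_ne_zero
  have hlim : Tendsto (fun r : ℝ => ∑ k : Fin n, r ^ (k : ℕ) * F k (r ^ 2) *
      (exp (L k₀ * r ^ 2) / r ^ (k₀ : ℕ))) atTop (𝓝 (∑ k : Fin n, if k = k₀ then C k₀ else 0)) := by
    refine tendsto_finsetSum _ fun k _ => ?_
    by_cases hk : ∀ s, 0 < s → F k s = 0
    · have hkk : k ≠ k₀ := by
        rintro rfl
        exact hk₀ hk
      rw [if_neg hkk]
      refine tendsto_const_nhds.congr' ?_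
      filter_upwards [eventually_gt_atTop 0] with r hr
      simp [hk (r ^ 2) (by positivity)]
    obtain ⟨-, hlimk⟩ := hLC k hk
    split_ifs with hkk
    · subst hkk
      refine (hlimk.comp hsq).congr' ?_
      filter_upwards [eventually_gt_atTop 0] with r hr
      simp only [Function.comp]
      field_simp
    · have hle := hmin k hk
      rw [Prod.Lex.toLex_le_toLex] at hle
      have hδ : 0 < L k - L k₀ ∨ L k - L k₀ = 0 ∧ (k : ℕ) < k₀ := by
        rcases hle with hle | ⟨h1, h2⟩
        · exact Or.inl (sub_pos.2 hle)
        · have : (k : ℕ) ≠ k₀ := fun h' => hkk (Fin.ext h')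
          simp only at h1 h2
          exact Or.inr ⟨by linarith, by omega⟩
      have := (hlimk.comp hsq).mul (tendsto_pow_div_pow_mul_exp_neg hδ)
      rw [mul_zero] at this
      refine this.congr fun r => ?_
      have e : exp (L k₀ * r ^ 2) = exp (L k * r ^ 2) * exp (-((L k - L k₀) * r ^ 2)) := by
        rw [← exp_add]
        ring_nf
      simp only [Function.comp]
      rw [e]
      ring
  rw [Finset.sum_ite_eq' Finset.univ k₀, if_pos (Finset.mem_univ _)] at hlim
  refine (hLC k₀ hk₀).1 (tendsto_nhds_unique hlim (tendsto_const_nhds.congr' ?_))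
  filter_upwards [eventually_gt_atTop 0] with r hr
  rw [← Finset.sum_mul, h r hr, zero_mul]

/-- The theta function `∑ₘ e^{-c²(m + x)² s}` of the shifted lattice `c(ℤ + x)`. -/
noncomputable def shiftedTheta (x c s : ℝ) : ℝ := ∑' m : ℤ, exp (-(c ^ 2 * (m + x) ^ 2) * s)

theorem finite_setOf_mul_add_sq_le {c : ℝ} (hc : 0 < c) (x L : ℝ) :
    {m : ℤ | c ^ 2 * ((m : ℝ) + x) ^ 2 ≤ L}.Finite := by
  obtain ⟨N, hN⟩ := exists_nat_ge (|x| + (L / c ^ 2 + 1))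
  refine (Set.finite_Icc (-(N : ℤ)) N).subset fun m hm => ?_
  simp only [Set.mem_ofPred_eq] at hm
  have h1 : ((m : ℝ) + x) ^ 2 ≤ L / c ^ 2 := by
    rw [le_div_iff₀ (by positivity)]
    linarith
  have h2 : |(m : ℝ) + x| ≤ L / c ^ 2 + 1 := by
    rw [← sq_abs] at h1
    nlinarith [sq_nonneg (|(m : ℝ) + x| - 1), abs_nonneg ((m : ℝ) + x)]
  have h3 : |(m : ℝ)| ≤ N := by
    have := abs_sub ((m : ℝ) + x) x
    rw [add_sub_cancel_right] at this
    linarith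
  rw [abs_le] at h3
  exact ⟨by exact_mod_cast h3.1, by exact_mod_cast h3.2⟩

theorem hasSum_shiftedTheta (x : ℝ) {c s : ℝ} (hc : 0 < c) (hs : 0 < s) :
    HasSum (fun m : ℤ => exp (-(c ^ 2 * ((m : ℝ) + x) ^ 2) * s)) (shiftedTheta x c s) := by
  refine Summable.hasSum ?_
  have := (HurwitzKernelBounds.summable_f_int 0 x (t := c ^ 2 * s / π) (by positivity))
  refine this.congr fun m => ?_
  simp only [HurwitzKernelBounds.f_int, pow_zero, one_mul]
  congr 1
  field_simp

theorem shiftedTheta_pos (x : ℝ) {c s : ℝ} (hc : 0 < c) (hs : 0 < s) : 0 < shiftedTheta x c s :=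
  (hasSum_shiftedTheta x hc hs).summable.tsum_pos (fun _ => (exp_pos _).le) 0 (exp_pos _)

theorem isDirichletSum_shiftedTheta (x : ℝ) {c : ℝ} (hc : 0 < c) :
    IsDirichletSum (shiftedTheta x c) :=
  ⟨ℤ, fun _ => 1, fun m => c ^ 2 * ((m : ℝ) + x) ^ 2, fun _ => by positivity,
    finite_setOf_mul_add_sq_le hc x, fun s hs => by
      simpa only [one_mul] using hasSum_shiftedTheta x hc hs⟩

theorem tendsto_shiftedTheta_zero {c : ℝ} (hc : 0 < c) :
    Tendsto (shiftedTheta 0 c) atTop (𝓝 1) := by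
  have := tendsto_mul_exp_of_hasSum (F := shiftedTheta 0 c) (c := fun _ : ℤ => 1)
    (l := fun m => c ^ 2 * ((m : ℝ) + 0) ^ 2) (L := 0)
    (fun s hs => by simpa only [one_mul] using hasSum_shiftedTheta 0 hc hs)
    (fun _ _ => by positivity)
  simpa [hc.ne'] using this

theorem tendsto_shiftedTheta_zero_sub_one_mul_exp {c L : ℝ} (hc : 0 < c) (hL : L ≤ c)
    (hL0 : 0 < L) :
    Tendsto (fun s => (shiftedTheta 0 c s - 1) * exp (L ^ 2 * s)) atTop
      (𝓝 (if c = L then 2 else 0)) := by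
  have := tendsto_mul_exp_of_hasSum (F := fun s => shiftedTheta 0 c s - 1)
    (c := fun m : ℤ => if m = 0 then 0 else 1)
    (l := fun m => c ^ 2 * ((m : ℝ) + 0) ^ 2) (L := L ^ 2)
    (fun s hs => by
      refine ((hasSum_shiftedTheta 0 hc hs).sub (hasSum_ite_eq (0 : ℤ) (1 : ℝ))).congr_fun fun m => ?_
      split_ifs with h <;> simp [h])
    (fun m hm => by
      have hm0 : m ≠ 0 := by
        rintro rfl
        simp at hm
      have h1 : (1 : ℝ) ≤ ((m : ℝ) + 0) ^ 2 := by
        rw [add_zero, one_le_sq_iff_one_le_abs]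
        exact_mod_cast Int.one_le_abs hm0
      nlinarith [mul_self_le_mul_self hL0.le hL])
  convert this using 2
  rw [tsum_eq_sum (s := {1, -1})]
  · rw [Finset.sum_pair (by norm_num)]
    have : c ^ 2 = L ^ 2 ↔ c = L := by
      rw [sq_eq_sq₀ hc.le hL0.le]
    simp only [add_zero, Int.cast_one, Int.cast_neg, neg_sq, one_pow, mul_one, this, one_ne_zero,
      neg_eq_zero, if_false]
    split_ifs <;> norm_num
  · intro m hm
    simp only [Finset.mem_insert, Finset.mem_singleton, not_or] at hm
    by_cases hm0 : m = 0
    · simp [hm0]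
    refine if_neg fun h => ?_
    have h1 : (2 : ℝ) ≤ |(m : ℝ)| := by
      have : (2 : ℤ) ≤ |m| := by
        rcases abs_cases m with h | h <;> omega
      exact_mod_cast this
    rw [add_zero, ← sq_abs (m : ℝ)] at h
    nlinarith [mul_self_le_mul_self hL0.le hL, mul_self_le_mul_self zero_le_two h1,
      mul_pos hc hc]

theorem tendsto_shiftedTheta_half_mul_exp {c L : ℝ} (hc : 0 < c) (hL : L ≤ c) (hL0 : 0 < L) :
    Tendsto (fun s => shiftedTheta (1 / 2) c s * exp (L ^ 2 / 4 * s)) atTop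
      (𝓝 (if c = L then 2 else 0)) := by
  have := tendsto_mul_exp_of_hasSum (F := shiftedTheta (1 / 2) c)
    (c := fun m : ℤ => 1)
    (l := fun m => c ^ 2 * ((m : ℝ) + 1 / 2) ^ 2) (L := L ^ 2 / 4)
    (fun s hs => by simpa only [one_mul] using hasSum_shiftedTheta (1 / 2) hc hs)
    (fun m _ => by
      have h1 : (0 : ℝ) ≤ m * (m + 1) := by
        have : 0 ≤ m * (m + 1) := by
          rcases le_or_gt 0 m with h | h
          · positivity
          · nlinarith
        exact_mod_cast this
      nlinarith [mul_self_le_mul_self hL0.le hL, mul_nonneg (mul_pos hc hc).le h1])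
  convert this using 2
  rw [tsum_eq_sum (s := {0, -1})]
  · rw [Finset.sum_pair (by norm_num)]
    have h1 : c ^ 2 * (((0 : ℤ) : ℝ) + 1 / 2) ^ 2 = L ^ 2 / 4 ↔ c = L := by
      rw [← sq_eq_sq₀ hc.le hL0.le]
      constructor <;> intro h <;> norm_num at h ⊢ <;> linarith
    have h2 : c ^ 2 * (((-1 : ℤ) : ℝ) + 1 / 2) ^ 2 = L ^ 2 / 4 ↔ c = L := by
      rw [← sq_eq_sq₀ hc.le hL0.le]
      constructor <;> intro h <;> norm_num at h ⊢ <;> linarith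
    simp only [h1, h2]
    split_ifs <;> norm_num
  · intro m hm
    simp only [Finset.mem_insert, Finset.mem_singleton, not_or] at hm
    refine if_neg fun h => ?_
    have h1 : (2 : ℝ) ≤ m * (m + 1) := by
      have : 2 ≤ m * (m + 1) := by
        rcases le_or_gt 0 m with h | h
        · nlinarith [show 1 ≤ m by omega]
        · nlinarith [show m ≤ -2 by omega]
      exact_mod_cast this
    nlinarith [mul_self_le_mul_self hL0.le hL,
      mul_le_mul_of_nonneg_left h1 (mul_pos hc hc).le, mul_pos hc hc]

theorem tsum_rectLattice_eq_tsum_int {a₁ a₂ a₃ : ℝ} (ha₁ : a₁ ≠ 0) (ha₂ : a₂ ≠ 0) (ha₃ : a₃ ≠ 0)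
    (g : ℝ → ℝ) :
    ∑' v : rectLattice a₁ a₂ a₃, g (‖(v : EuclideanSpace ℝ (Fin 3))‖ ^ 2) =
      ∑' m : ℤ × ℤ × ℤ, g ((a₁ * m.1) ^ 2 + (a₂ * m.2.1) ^ 2 + (a₃ * m.2.2) ^ 2) := by
  obtain ⟨f, hfm⟩ : ∃ f : ℤ × ℤ × ℤ → EuclideanSpace ℝ (Fin 3), ∀ m, f m =
      (WithLp.equiv 2 (Fin 3 → ℝ)).symm ![a₁ * m.1, a₂ * m.2.1, a₃ * m.2.2] := ⟨_, fun _ => rfl⟩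
  have hf : Function.Injective f := by
    rintro ⟨m₁, m₂, m₃⟩ ⟨n₁, n₂, n₃⟩ h
    rw [hfm, hfm] at h
    have e := (WithLp.equiv 2 (Fin 3 → ℝ)).symm.injective h
    have e1 := congrFun e 0
    have e2 := congrFun e 1
    have e3 := congrFun e 2
    simp [ha₁, ha₂, ha₃] at e1 e2 e3
    simp [e1, e2, e3]
  have hr : rectLattice a₁ a₂ a₃ = Set.range f := by
    ext v
    simp only [rectLattice, Set.mem_ofPred_eq, Set.mem_range, hfm, eq_comm]
  rw [hr, tsum_range (fun v => g (‖v‖ ^ 2)) hf]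
  refine tsum_congr fun m => ?_
  rw [EuclideanSpace.norm_sq_eq]
  simp [hfm, Fin.sum_univ_three]

theorem HasSum.mul_mul_real {ι κ τ : Type*} {f : ι → ℝ} {g : κ → ℝ} {h : τ → ℝ} {x y z : ℝ}
    (hf : HasSum f x) (hg : HasSum g y) (hh : HasSum h z) :
    HasSum (fun p : ι × κ × τ => f p.1 * (g p.2.1 * h p.2.2)) (x * (y * z)) := by
  have hgh := hg.mul hh (summable_mul_of_summable_norm hg.summable.norm hh.summable.norm)
  exact hf.mul hgh (summable_mul_of_summable_norm hf.summable.norm hgh.summable.norm)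

theorem tsum_rectLattice {a₁ a₂ a₃ s : ℝ} (ha₁ : 0 < a₁) (ha₂ : 0 < a₂) (ha₃ : 0 < a₃)
    (hs : 0 < s) :
    ∑' v : rectLattice a₁ a₂ a₃, exp (-‖(v : EuclideanSpace ℝ (Fin 3))‖ ^ 2 * s) =
      shiftedTheta 0 a₁ s * (shiftedTheta 0 a₂ s * shiftedTheta 0 a₃ s) := by
  rw [tsum_rectLattice_eq_tsum_int ha₁.ne' ha₂.ne' ha₃.ne' fun x => exp (-x * s)]
  refine (((hasSum_shiftedTheta 0 ha₁ hs).mul_mul_real (hasSum_shiftedTheta 0 ha₂ hs)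
    (hasSum_shiftedTheta 0 ha₃ hs)).congr_fun fun m => ?_).tsum_eq
  rw [← exp_add, ← exp_add]
  ring_nf

theorem tsum_prod_shiftedTheta (x y : ℝ) {a b s : ℝ} (ha : 0 < a) (hb : 0 < b) (hs : 0 < s) :
    ∑' p : ℤ × ℤ, exp (-(a ^ 2 * ((p.1 : ℝ) + x) ^ 2 + b ^ 2 * ((p.2 : ℝ) + y) ^ 2) * s) =
      shiftedTheta x a s * shiftedTheta y b s := by
  have h1 := hasSum_shiftedTheta x ha hs
  have h2 := hasSum_shiftedTheta y hb hs
  rw [← (h1.mul h2 (summable_mul_of_summable_norm h1.summable.norm h2.summable.norm)).tsum_eq]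
  refine tsum_congr fun p => ?_
  rw [← exp_add]
  ring_nf

theorem N3trace_eq {a₁ a₂ a₃ r : ℝ} (ha₁ : 0 < a₁) (ha₂ : 0 < a₂) (ha₃ : 0 < a₃) (hr : 0 < r) :
    4 * √π * N3trace a₁ a₂ a₃ (1 / (4 * r ^ 2)) =
      r * (a₁ * shiftedTheta (1 / 2) a₁ (r ^ 2) +
      r * ((√π)⁻¹ * (a₁ * (a₂ * (shiftedTheta 0 a₁ (r ^ 2) * shiftedTheta (1 / 2) a₂ (r ^ 2)) +
        a₃ * (shiftedTheta (1 / 2) a₁ (r ^ 2) * shiftedTheta 0 a₃ (r ^ 2))))) +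
      r ^ 2 * (π⁻¹ * (a₁ * a₂ * a₃ * (shiftedTheta 0 a₁ (r ^ 2) * (shiftedTheta 0 a₂ (r ^ 2) *
        shiftedTheta 0 a₃ (r ^ 2)))))) := by
  have hs : 0 < r ^ 2 := by positivity
  have hpi : 0 < √π := by positivity
  have hsq : √π ^ 2 = π := sq_sqrt pi_pos.le
  have hdiv : ∀ y : ℝ, y / (4 * (1 / (4 * r ^ 2))) = y * r ^ 2 := fun y => by
    field_simp
  have hpow : (4 * π * (1 / (4 * r ^ 2))) ^ ((3 : ℝ) / 2) = π * √π / r ^ 3 := by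
    rw [show 4 * π * (1 / (4 * r ^ 2)) = (√π / r) ^ (2 : ℝ) by
      rw [rpow_two, div_pow, hsq]
      field_simp, ← rpow_mul (by positivity)]
    norm_num
    rw [div_pow, pow_succ, hsq]
  have hsqrt : √(π * (1 / (4 * r ^ 2))) = √π / (2 * r) := by
    rw [sqrt_mul pi_pos.le, show 1 / (4 * r ^ 2) = (1 / (2 * r)) ^ 2 by ring,
      sqrt_sq (by positivity)]
    ring
  have e1 := tsum_rectLattice ha₁ ha₂ ha₃ hs
  have e2 := tsum_prod_shiftedTheta 0 (1 / 2) ha₁ ha₂ hs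
  have e3 := tsum_prod_shiftedTheta (1 / 2) 0 ha₁ ha₃ hs
  have e4 : ∑' m : ℤ, exp (-((m : ℝ) + 1 / 2) ^ 2 * a₁ ^ 2 * r ^ 2) =
      shiftedTheta (1 / 2) a₁ (r ^ 2) := tsum_congr fun m => by ring_nf
  simp only [add_zero] at e2 e3
  simp only [N3trace, hdiv, hpow, hsqrt, e1, e2, e3, e4]
  field_simp
  linear_combination 128 * r * (a₂ * shiftedTheta 0 a₁ (r ^ 2) * shiftedTheta (1 / 2) a₂ (r ^ 2) +
    a₃ * shiftedTheta 0 a₃ (r ^ 2) * shiftedTheta (1 / 2) a₁ (r ^ 2)) * hsq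

theorem min_eq_min_of_shiftedTheta_mul_eq {a b c d : ℝ} (ha : 0 < a) (hb : 0 < b) (hc : 0 < c)
    (hd : 0 < d) (h : ∀ s, 0 < s → shiftedTheta 0 a s * shiftedTheta 0 b s =
      shiftedTheta 0 c s * shiftedTheta 0 d s) : min a b = min c d := by
  have main : ∀ {a b : ℝ}, 0 < a → 0 < b → ∃ C, C ≠ 0 ∧
      Tendsto (fun s => (shiftedTheta 0 a s * shiftedTheta 0 b s - 1) * exp (min a b ^ 2 * s))
        atTop (𝓝 C) := by
    intro a b ha hb
    have hm := lt_min ha hb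
    have h1 := tendsto_shiftedTheta_zero_sub_one_mul_exp ha (min_le_left a b) hm
    have h2 := tendsto_shiftedTheta_zero_sub_one_mul_exp hb (min_le_right a b) hm
    refine ⟨_, ?_, ((h1.mul (tendsto_shiftedTheta_zero hb)).add h2).congr fun s => by ring⟩
    rcases min_choice a b with h | h <;> simp only [h, if_true] <;> split_ifs <;> norm_num
  obtain ⟨C, hC, h1⟩ := main ha hb
  obtain ⟨D, hD, h2⟩ := main hc hd
  have h3 := eq_of_tendsto_mul_exp hC hD h1 (h2.congr' (by
    filter_upwards [eventually_gt_atTop 0] with s hs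
    rw [h s hs]))
  exact (sq_eq_sq₀ (lt_min ha hb).le (lt_min hc hd).le).1 h3

theorem not_lt_of_shiftedTheta_swap_eq {a b c : ℝ} (ha : 0 < a) (hb : 0 < b) (hc : 0 < c)
    (h : ∀ s, 0 < s →
      b * (shiftedTheta 0 a s * shiftedTheta (1 / 2) b s) +
        c * (shiftedTheta (1 / 2) a s * shiftedTheta 0 c s) =
      c * (shiftedTheta 0 a s * shiftedTheta (1 / 2) c s) +
        b * (shiftedTheta (1 / 2) a s * shiftedTheta 0 b s)) : ¬ b < c := by
  intro hbc
  have hm := lt_min ha hb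
  have hmc : min a b < c := (min_le_right a b).trans_lt hbc
  have h1 := tendsto_shiftedTheta_half_mul_exp ha (min_le_left a b) hm
  have h2 := tendsto_shiftedTheta_half_mul_exp hb (min_le_right a b) hm
  have h3 := tendsto_shiftedTheta_half_mul_exp hc hmc.le hm
  have t1 := tendsto_shiftedTheta_zero ha
  have t2 := tendsto_shiftedTheta_zero hb
  have t3 := tendsto_shiftedTheta_zero hc
  have hl := ((t1.mul h2).const_mul b).add ((h1.mul t3).const_mul c)
  have hr := ((t1.mul h3).const_mul c).add ((h1.mul t2).const_mul b)
  have e := tendsto_nhds_unique hl (hr.congr' (by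
    filter_upwards [eventually_gt_atTop 0] with s hs
    linear_combination -exp (min a b ^ 2 / 4 * s) * h s hs))
  rw [if_neg hmc.ne'] at e
  rcases min_choice a b with h | h <;> simp only [h, if_true] at e <;> split_ifs at e <;> linarith

/-- Case `N₃` of Theorem B: two flat 3-manifolds of type `N₃` with equal trace functions
have the same ordered triple of parameters. -/
theorem N3_isospectral_implies_isometric
    (a₁ a₂ a₃ b₁ b₂ b₃ : ℝ)
    (ha₁ : 0 < a₁) (ha₂ : 0 < a₂) (ha₃ : 0 < a₃)
    (hb₁ : 0 < b₁) (hb₂ : 0 < b₂) (hb₃ : 0 < b₃)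
    (heq : ∀ t : ℝ, 0 < t → N3trace a₁ a₂ a₃ t = N3trace b₁ b₂ b₃ t) :
    a₁ = b₁ ∧ a₂ = b₂ ∧ a₃ = b₃ := by
  have h_sep := eq_zero_of_sum_pow_mul_eq_zero
    (F := ![fun s => a₁ * shiftedTheta (1 / 2) a₁ s + -1 * (b₁ * shiftedTheta (1 / 2) b₁ s),
      fun s => (√π)⁻¹ * (a₁ * (a₂ * (shiftedTheta 0 a₁ s * shiftedTheta (1 / 2) a₂ s) +
          a₃ * (shiftedTheta (1 / 2) a₁ s * shiftedTheta 0 a₃ s))) +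
        -1 * ((√π)⁻¹ * (b₁ * (b₂ * (shiftedTheta 0 b₁ s * shiftedTheta (1 / 2) b₂ s) +
          b₃ * (shiftedTheta (1 / 2) b₁ s * shiftedTheta 0 b₃ s)))),
      fun s => π⁻¹ * (a₁ * a₂ * a₃ *
          (shiftedTheta 0 a₁ s * (shiftedTheta 0 a₂ s * shiftedTheta 0 a₃ s))) +
        -1 * (π⁻¹ * (b₁ * b₂ * b₃ *
          (shiftedTheta 0 b₁ s * (shiftedTheta 0 b₂ s * shiftedTheta 0 b₃ s))))])
    (by
      have D : ∀ x {c : ℝ}, 0 < c → IsDirichletSum (shiftedTheta x c) :=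
        fun x _ => isDirichletSum_shiftedTheta x
      intro k
      fin_cases k
      · exact ((D _ ha₁).const_mul _).add (((D _ hb₁).const_mul _).const_mul _)
      · exact ((((((D _ ha₁).mul (D _ ha₂)).const_mul _).add
          (((D _ ha₁).mul (D _ ha₃)).const_mul _)).const_mul _).const_mul _).add
          (((((((D _ hb₁).mul (D _ hb₂)).const_mul _).add
          (((D _ hb₁).mul (D _ hb₃)).const_mul _)).const_mul _).const_mul _).const_mul _)
      · exact ((((D _ ha₁).mul ((D _ ha₂).mul (D _ ha₃))).const_mul _).const_mul _).add
          (((((D _ hb₁).mul ((D _ hb₂).mul (D _ hb₃))).const_mul _).const_mul _).const_mul _))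
    (by
      intro r hr
      have e := congrArg (fun x => 4 * √π * x) (heq (1 / (4 * r ^ 2)) (by positivity))
      simp only [N3trace_eq ha₁ ha₂ ha₃ hr, N3trace_eq hb₁ hb₂ hb₃ hr] at e
      refine (mul_eq_zero.1 ?_).resolve_left hr.ne'
      simp only [Fin.sum_univ_three, Fin.val_zero, Fin.val_one, Fin.val_two, pow_zero, pow_one,
        Matrix.cons_val]
      linear_combination e)
  have hE : ∀ s, 0 < s → a₁ * shiftedTheta (1 / 2) a₁ s = b₁ * shiftedTheta (1 / 2) b₁ s := by
    intro s hs
    have := h_sep 0 s hs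
    simp only [Matrix.cons_val] at this
    linarith
  have h₁ : a₁ = b₁ := by
    have hl := (tendsto_shiftedTheta_half_mul_exp ha₁ le_rfl ha₁).const_mul a₁
    have hr := (tendsto_shiftedTheta_half_mul_exp hb₁ le_rfl hb₁).const_mul b₁
    simp only [if_true, ← mul_assoc] at hl hr
    have := eq_of_tendsto_mul_exp (by positivity) (by positivity) hl (hr.congr' (by
      filter_upwards [eventually_gt_atTop 0] with s hs
      rw [hE s hs]))
    exact (sq_eq_sq₀ ha₁.le hb₁.le).1 (by linarith)
  subst h₁
  have hV : ∀ s, 0 < s → a₂ * a₃ *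
      (shiftedTheta 0 a₁ s * (shiftedTheta 0 a₂ s * shiftedTheta 0 a₃ s)) = b₂ * b₃ *
      (shiftedTheta 0 a₁ s * (shiftedTheta 0 b₂ s * shiftedTheta 0 b₃ s)) := by
    intro s hs
    have := h_sep 2 s hs
    simp only [Matrix.cons_val] at this
    have hne : π⁻¹ * a₁ ≠ 0 := by positivity
    refine mul_left_cancel₀ hne ?_
    linear_combination this
  have hA : ∀ s, 0 < s →
      a₂ * (shiftedTheta 0 a₁ s * shiftedTheta (1 / 2) a₂ s) +
        a₃ * (shiftedTheta (1 / 2) a₁ s * shiftedTheta 0 a₃ s) =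
      b₂ * (shiftedTheta 0 a₁ s * shiftedTheta (1 / 2) b₂ s) +
        b₃ * (shiftedTheta (1 / 2) a₁ s * shiftedTheta 0 b₃ s) := by
    intro s hs
    have := h_sep 1 s hs
    simp only [Matrix.cons_val] at this
    have hne : (√π)⁻¹ * a₁ ≠ 0 := by positivity
    refine mul_left_cancel₀ hne ?_
    linear_combination this
  have T : ∀ {c : ℝ}, 0 < c → Tendsto (shiftedTheta 0 c) atTop (𝓝 1) := tendsto_shiftedTheta_zero
  have hprod : a₂ * a₃ = b₂ * b₃ := by
    have hl := ((T ha₁).mul ((T ha₂).mul (T ha₃))).const_mul (a₂ * a₃)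
    have hr := ((T ha₁).mul ((T hb₂).mul (T hb₃))).const_mul (b₂ * b₃)
    simp only [mul_one] at hl hr
    refine tendsto_nhds_unique hl (hr.congr' ?_)
    filter_upwards [eventually_gt_atTop 0] with s hs
    exact (hV s hs).symm
  have hmin : min a₂ a₃ = min b₂ b₃ := by
    refine min_eq_min_of_shiftedTheta_mul_eq ha₂ ha₃ hb₂ hb₃ fun s hs => ?_
    have h := hV s hs
    rw [← hprod] at h
    have := shiftedTheta_pos 0 ha₁ hs
    have hne : a₂ * a₃ * shiftedTheta 0 a₁ s ≠ 0 := by positivity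
    refine mul_left_cancel₀ hne ?_
    linear_combination h
  refine ⟨rfl, ?_⟩
  have hcases : a₂ = b₂ ∧ a₃ = b₃ ∨ a₂ = b₃ ∧ a₃ = b₂ := by
    rcases min_choice a₂ a₃ with h | h <;> rcases min_choice b₂ b₃ with h' | h' <;>
      rw [h, h'] at hmin <;> subst hmin
    · exact Or.inl ⟨rfl, mul_left_cancel₀ ha₂.ne' hprod⟩
    · exact Or.inr ⟨rfl, mul_left_cancel₀ ha₂.ne' (hprod.trans (mul_comm _ _))⟩
    · exact Or.inr ⟨mul_right_cancel₀ ha₃.ne' (hprod.trans (mul_comm _ _)), rfl⟩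
    · exact Or.inl ⟨mul_right_cancel₀ ha₃.ne' hprod, rfl⟩
  rcases hcases with h | ⟨rfl, rfl⟩
  · exact h
  have h : a₂ = a₃ := le_antisymm
    (not_lt.1 (not_lt_of_shiftedTheta_swap_eq ha₁ ha₃ ha₂ fun s hs => (hA s hs).symm))
    (not_lt.1 (not_lt_of_shiftedTheta_swap_eq ha₁ ha₂ ha₃ hA))
  exact ⟨h, h.symm⟩
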